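/- (Upper singular-value bound for the preconditioned IMEX scheme.) Let N_x ≥ 5, N_t ≥ 2, and let τ, h ∈ (0,1] with β = τ/h ≤ 1, and let ε ≥ 0. With n = N_x − 1, set A = (β/2)·M_h and B = I_n + (β/2)·L_h, and let L̃ be the square matrix of size 2·N_t·n with 2×2 outer block structure L̃ = [[L₁₁, L₁₂],[L₂₁, L₂₂]], where each L_{pq} is an N_t×N_t array of n×n blocks: L₁₁ has I_n on the block diagonal and −B on the first block subdiagonal; L₁₂ has A on the first block subdiagonal and 0 elsewhere; L₂₁ has ((1−ε)/(1+ε))·A on the block diagonal and (ε/(1+ε))·A on the first block subdiagonal; L₂₂ has ((τ+ε)/(1+ε))·I_n on the block diagonal and −(ε/(1+ε))·B on the first block subdiagonal. Then every singular value σ of L̃ satisfies σ ≤ 2 + β. -/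

import Mathlib

open Matrix

def IsSingularValue {𝕜 : Type*} [RCLike 𝕜] {n : Type*} [Fintype n] [DecidableEq n]
    (M : Matrix n n 𝕜) (σ : ℝ) : Prop :=
  0 ≤ σ ∧ algebraMap ℝ 𝕜 (σ ^ 2) ∈ spectrum 𝕜 (M * Mᴴ)

/-- The `(Nx-1) × (Nx-1)` central-difference matrix `L_h`: symmetric tridiagonal with
`-2` on the main diagonal and `1` on the first sub- and super-diagonals. -/
def Lh (n : ℕ) : Matrix (Fin n) (Fin n) ℝ :=
  fun i j => if i = j then -2 else if (i : ℕ) = (j : ℕ) + 1 ∨ (j : ℕ) = (i : ℕ) + 1 then 1 else 0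

/-- The `(Nx-1) × (Nx-1)` central-difference matrix `M_h`: tridiagonal with `0` on the
main diagonal, `1` on the first superdiagonal and `-1` on the first subdiagonal. -/
def Mh (n : ℕ) : Matrix (Fin n) (Fin n) ℝ :=
  fun i j => if (j : ℕ) = (i : ℕ) + 1 then 1 else if (i : ℕ) = (j : ℕ) + 1 then -1 else 0

/-- The `Nt·n × Nt·n` block matrix, organized as an `Nt × Nt` array of `n × n` blocks,
with `D` on the block diagonal, `S` on the first block subdiagonal, and `0` elsewhere. -/
def blockBidiag {Nt n : ℕ} (D S : Matrix (Fin n) (Fin n) ℝ) :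
    Matrix (Fin Nt × Fin n) (Fin Nt × Fin n) ℝ :=
  fun p q =>
    if p.1 = q.1 then D p.2 q.2
    else if (p.1 : ℕ) = (q.1 : ℕ) + 1 then S p.2 q.2 else 0

open scoped Matrix.Norms.L2Operator Kronecker

/-- All absolute row sums and all absolute column sums of `M` are at most `r`. -/
def AbsSumsLE {m n : Type*} [Fintype m] [Fintype n] (M : Matrix m n ℝ) (r : ℝ) : Prop :=
  (∀ i, ∑ j, |M i j| ≤ r) ∧ ∀ j, ∑ i, |M i j| ≤ r

namespace AbsSumsLE

variable {l m n p : Type*} [Fintype l] [Fintype m] [Fintype n] [Fintype p]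

lemma transpose {M : Matrix m n ℝ} {r : ℝ} (h : AbsSumsLE M r) : AbsSumsLE Mᵀ r :=
  ⟨h.2, h.1⟩

lemma mono {M : Matrix m n ℝ} {r s : ℝ} (h : AbsSumsLE M r) (hrs : r ≤ s) : AbsSumsLE M s :=
  ⟨fun i => (h.1 i).trans hrs, fun j => (h.2 j).trans hrs⟩

lemma add {M N : Matrix m n ℝ} {r s : ℝ} (hM : AbsSumsLE M r) (hN : AbsSumsLE N s) :
    AbsSumsLE (M + N) (r + s) := by
  constructor
  · intro i
    calc ∑ j, |(M + N) i j| ≤ ∑ j, (|M i j| + |N i j|) :=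
          Finset.sum_le_sum fun j _ => abs_add_le _ _
      _ ≤ r + s := by
          rw [Finset.sum_add_distrib]
          exact add_le_add (hM.1 i) (hN.1 i)
  · intro j
    calc ∑ i, |(M + N) i j| ≤ ∑ i, (|M i j| + |N i j|) :=
          Finset.sum_le_sum fun i _ => abs_add_le _ _
      _ ≤ r + s := by
          rw [Finset.sum_add_distrib]
          exact add_le_add (hM.2 j) (hN.2 j)

lemma smul {M : Matrix m n ℝ} {r : ℝ} (h : AbsSumsLE M r) (c : ℝ) :
    AbsSumsLE (c • M) (|c| * r) := by
  constructor
  · intro i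
    simp only [Matrix.smul_apply, smul_eq_mul, abs_mul, ← Finset.mul_sum]
    exact mul_le_mul_of_nonneg_left (h.1 i) (abs_nonneg c)
  · intro j
    simp only [Matrix.smul_apply, smul_eq_mul, abs_mul, ← Finset.mul_sum]
    exact mul_le_mul_of_nonneg_left (h.2 j) (abs_nonneg c)

lemma neg {M : Matrix m n ℝ} {r : ℝ} (h : AbsSumsLE M r) : AbsSumsLE (-M) r := by
  simpa [AbsSumsLE] using h

lemma one [DecidableEq n] : AbsSumsLE (1 : Matrix n n ℝ) 1 := by
  constructor <;> intro i <;> simp [Matrix.one_apply, apply_ite abs]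

lemma kronecker {M : Matrix l m ℝ} {N : Matrix n p ℝ} {r s : ℝ} (hr : 0 ≤ r)
    (hM : AbsSumsLE M r) (hN : AbsSumsLE N s) : AbsSumsLE (M ⊗ₖ N) (r * s) := by
  constructor
  · rintro ⟨i, k⟩
    simp only [Matrix.kroneckerMap_apply, abs_mul, Fintype.sum_prod_type, ← Finset.mul_sum,
      ← Finset.sum_mul]
    exact mul_le_mul (hM.1 i) (hN.1 k) (Finset.sum_nonneg fun _ _ => abs_nonneg _) hr
  · rintro ⟨i, k⟩
    simp only [Matrix.kroneckerMap_apply, abs_mul, Fintype.sum_prod_type, ← Finset.mul_sum,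
      ← Finset.sum_mul]
    exact mul_le_mul (hM.2 i) (hN.2 k) (Finset.sum_nonneg fun _ _ => abs_nonneg _) hr

lemma fromBlocks_diagonal {M : Matrix l m ℝ} {N : Matrix n p ℝ} {r : ℝ}
    (hM : AbsSumsLE M r) (hN : AbsSumsLE N r) : AbsSumsLE (fromBlocks M 0 0 N) r := by
  constructor
  · rintro (i | i)
    · simpa using hM.1 i
    · simpa using hN.1 i
  · rintro (i | i)
    · simpa using hM.2 i
    · simpa using hN.2 i

lemma fromBlocks_lowerLeft {M : Matrix n m ℝ} {r : ℝ} (hr : 0 ≤ r) (hM : AbsSumsLE M r) :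
    AbsSumsLE (fromBlocks (0 : Matrix l m ℝ) (0 : Matrix l p ℝ) M 0) r := by
  constructor
  · rintro (i | i)
    · simpa using hr
    · simpa using hM.1 i
  · rintro (i | i)
    · simpa using hM.2 i
    · simpa using hr

/-- **Schur test**: a common bound on absolute row and column sums bounds the `ℓ²` operator norm. -/
lemma l2_opNorm_le [DecidableEq n] {M : Matrix m n ℝ} {r : ℝ} (hr : 0 ≤ r)
    (h : AbsSumsLE M r) : ‖M‖ ≤ r := by
  rw [Matrix.l2_opNorm_def]
  refine ContinuousLinearMap.opNorm_le_bound _ hr fun x => ?_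
  refine le_of_sq_le_sq ?_ (by positivity)
  rw [mul_pow, EuclideanSpace.real_norm_sq_eq, EuclideanSpace.real_norm_sq_eq]
  have key : ∀ i, (∑ j, M i j * x j) ^ 2 ≤ r * ∑ j, |M i j| * x j ^ 2 := fun i =>
    calc (∑ j, M i j * x j) ^ 2 ≤ (∑ j, |M i j|) * ∑ j, |M i j| * x j ^ 2 := by
          refine Finset.sum_sq_le_sum_mul_sum_of_sq_le_mul _ (fun _ _ => abs_nonneg _)
            (fun _ _ => by positivity) fun j _ => ?_
          rw [mul_pow, ← sq_abs (M i j)]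
          exact le_of_eq (by ring)
      _ ≤ r * ∑ j, |M i j| * x j ^ 2 :=
          mul_le_mul_of_nonneg_right (h.1 i) (Finset.sum_nonneg fun _ _ => by positivity)
  calc _ = ∑ i, (∑ j, M i j * x j) ^ 2 := by
          simp [Matrix.mulVec, dotProduct]
    _ ≤ ∑ i, r * ∑ j, |M i j| * x j ^ 2 := Finset.sum_le_sum fun i _ => key i
    _ = r * ∑ j, (∑ i, |M i j|) * x j ^ 2 := by
          rw [← Finset.mul_sum, Finset.sum_comm]
          simp only [Finset.sum_mul]
    _ ≤ r * ∑ j, r * x j ^ 2 :=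
          mul_le_mul_of_nonneg_left
            (Finset.sum_le_sum fun j _ => mul_le_mul_of_nonneg_right (h.2 j) (sq_nonneg _)) hr
    _ = r ^ 2 * ∑ j, x j ^ 2 := by
          rw [← Finset.mul_sum]
          ring

end AbsSumsLE

/-- The lower shift matrix, with `1` on the first subdiagonal and `0` elsewhere. -/
def lowerShift (n : ℕ) : Matrix (Fin n) (Fin n) ℝ :=
  fun i j => if (i : ℕ) = (j : ℕ) + 1 then 1 else 0

lemma absSumsLE_lowerShift (n : ℕ) : AbsSumsLE (lowerShift n) 1 := by
  constructor <;> intro i <;>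
    simp only [lowerShift, apply_ite abs, abs_one, abs_zero, Finset.sum_boole] <;>
    norm_cast <;>
    refine Finset.card_le_one.2 fun a ha b hb => Fin.ext ?_ <;>
    simp only [Finset.mem_filter] at ha hb <;>
    omega

lemma Mh_eq (n : ℕ) : Mh n = (lowerShift n)ᵀ - lowerShift n := by
  ext i j
  simp only [Mh, lowerShift, Matrix.sub_apply, Matrix.transpose_apply]
  split_ifs <;> first | omega | norm_num

lemma Lh_eq (n : ℕ) : Lh n = lowerShift n + (lowerShift n)ᵀ - (2 : ℝ) • 1 := by
  ext i j
  simp only [Lh, lowerShift, Matrix.sub_apply, Matrix.add_apply, Matrix.transpose_apply,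
    Matrix.smul_apply, Matrix.one_apply, smul_eq_mul, Fin.ext_iff]
  split_ifs <;> first | omega | norm_num

lemma blockBidiag_eq {Nt n : ℕ} (D S : Matrix (Fin n) (Fin n) ℝ) :
    (blockBidiag D S : Matrix (Fin Nt × Fin n) (Fin Nt × Fin n) ℝ) =
      1 ⊗ₖ D + lowerShift Nt ⊗ₖ S := by
  ext ⟨a, i⟩ ⟨b, j⟩
  simp only [blockBidiag, lowerShift, Matrix.add_apply, Matrix.kroneckerMap_apply,
    Matrix.one_apply, Fin.ext_iff]
  split_ifs <;> first | omega | simp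

lemma IsSingularValue.le_l2_opNorm {n : Type*} [Fintype n] [DecidableEq n]
    {M : Matrix n n ℝ} {σ : ℝ} (h : IsSingularValue M σ) : σ ≤ ‖M‖ := by
  have h1 := spectrum.norm_le_norm_mul_of_mem h.2
  rcases isEmpty_or_nonempty n with hn | hn
  · exact absurd h.2 (by simp [spectrum.of_subsingleton])
  have h2 : ‖M * Mᴴ‖ ≤ ‖M‖ * ‖M‖ := by
    simpa only [Matrix.l2_opNorm_conjTranspose] using Matrix.l2_opNorm_mul M Mᴴ
  have h3 : σ ^ 2 ≤ ‖M‖ * ‖M‖ := by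
    simpa using h1.trans (by simpa using h2)
  exact le_of_sq_le_sq (by rwa [sq ‖M‖]) (norm_nonneg M)

/-- `[[X + Y, X - Y], [X - Y, X + Y]]` is twice an orthogonal conjugate of `diag(X, Y)`. -/
lemma l2_opNorm_fromBlocks_add_sub_le {n : Type*} [Fintype n] [DecidableEq n]
    (X Y : Matrix n n ℝ) :
    ‖fromBlocks (X + Y) (X - Y) (X - Y) (X + Y)‖ ≤ 2 * ‖fromBlocks X 0 0 Y‖ := by
  set H : Matrix (n ⊕ n) (n ⊕ n) ℝ := fromBlocks 1 1 1 (-1) with hH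
  have hHH : Hᴴ * H = (2 : ℝ) • 1 := by
    rw [hH, Matrix.fromBlocks_conjTranspose, Matrix.fromBlocks_multiply, ← Matrix.fromBlocks_one,
      Matrix.fromBlocks_smul]
    simp [two_smul]
  have hnorm : ‖H‖ * ‖H‖ ≤ 2 := by
    rw [← Matrix.l2_opNorm_conjTranspose_mul_self, hHH]
    exact ((AbsSumsLE.one.smul 2).mono (by norm_num)).l2_opNorm_le (by norm_num)
  have hfac : fromBlocks (X + Y) (X - Y) (X - Y) (X + Y) = H * fromBlocks X 0 0 Y * H := by
    simp [hH, Matrix.fromBlocks_multiply, sub_eq_add_neg]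
  rw [hfac]
  calc ‖H * fromBlocks X 0 0 Y * H‖ ≤ ‖H‖ * ‖fromBlocks X 0 0 Y‖ * ‖H‖ :=
        (Matrix.l2_opNorm_mul _ _).trans
          (mul_le_mul_of_nonneg_right (Matrix.l2_opNorm_mul _ _) (norm_nonneg _))
    _ = ‖H‖ * ‖H‖ * ‖fromBlocks X 0 0 Y‖ := by ring
    _ ≤ 2 * ‖fromBlocks X 0 0 Y‖ := mul_le_mul_of_nonneg_right hnorm (norm_nonneg _)

/-- **Upper singular-value bound for the preconditioned IMEX scheme.**
With `A = (β/2)·M_h`, `B = I + (β/2)·L_h` and `L̃` the preconditioned IMEX space-time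
coefficient matrix, every singular value `σ` of `L̃` satisfies `σ ≤ 2 + β`. -/
theorem stmt12 (Nx Nt : ℕ) (hNx : 5 ≤ Nx) (hNt : 2 ≤ Nt) (τ h β ε : ℝ)
    (hτ0 : 0 < τ) (hτ1 : τ ≤ 1) (hh0 : 0 < h) (hh1 : h ≤ 1)
    (hβ : β = τ / h) (hβ1 : β ≤ 1) (hε : 0 ≤ ε)
    (A B : Matrix (Fin (Nx - 1)) (Fin (Nx - 1)) ℝ)
    (hA : A = (β / 2) • Mh (Nx - 1)) (hB : B = 1 + (β / 2) • Lh (Nx - 1))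
    (Ltilde : Matrix ((Fin Nt × Fin (Nx - 1)) ⊕ (Fin Nt × Fin (Nx - 1)))
      ((Fin Nt × Fin (Nx - 1)) ⊕ (Fin Nt × Fin (Nx - 1))) ℝ)
    (hLt : Ltilde = Matrix.fromBlocks
      (blockBidiag 1 (-B))
      (blockBidiag 0 A)
      (blockBidiag (((1 - ε) / (1 + ε)) • A) ((ε / (1 + ε)) • A))
      (blockBidiag (((τ + ε) / (1 + ε)) • 1) (-((ε / (1 + ε)) • B)))) :
    ∀ σ : ℝ, IsSingularValue Ltilde σ → σ ≤ 2 + β := by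
  intro σ hσ
  refine hσ.le_l2_opNorm.trans ?_
  have hβ0 : 0 ≤ β := hβ ▸ (div_pos hτ0 hh0).le
  have hε1 : 0 < 1 + ε := by linarith
  have hc : |(1 - ε) / (1 + ε)| ≤ 1 := by
    rw [abs_div, abs_of_pos hε1, div_le_one hε1, abs_le]
    constructor <;> linarith
  have hd : |(τ + ε) / (1 + ε)| ≤ 1 := by
    rw [abs_div, abs_of_pos hε1, div_le_one hε1, abs_le]
    constructor <;> linarith
  have hs : |ε / (1 + ε)| ≤ 1 := by
    rw [abs_div, abs_of_pos hε1, div_le_one hε1, abs_le]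
    constructor <;> linarith
  generalize (1 - ε) / (1 + ε) = c at *
  generalize (τ + ε) / (1 + ε) = d at *
  generalize ε / (1 + ε) = s at *
  set K := lowerShift (Nx - 1)
  set T := lowerShift Nt with hTdef
  have hK : AbsSumsLE K 1 := absSumsLE_lowerShift _
  have hT : AbsSumsLE T 1 := absSumsLE_lowerShift _
  have hA' : AbsSumsLE A β := by
    have h1 : A = (β / 2) • (Kᵀ + -K) := by rw [hA, Mh_eq, sub_eq_add_neg]
    rw [h1]
    refine ((hK.transpose.add hK.neg).smul _).mono ?_
    rw [abs_of_nonneg (by positivity)]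
    linarith
  have hX : AbsSumsLE (A - B) 1 := by
    have h1 : A - B = -((1 - β) • 1 + β • K) := by
      rw [hA, hB, Mh_eq, Lh_eq]
      module
    rw [h1]
    refine ((AbsSumsLE.one.smul _).add (hK.smul _)).neg.mono ?_
    rw [abs_of_nonneg (sub_nonneg.2 hβ1), abs_of_nonneg hβ0]
    linarith
  have hY : AbsSumsLE (-A - B) 1 := by
    have h1 : -A - B = -((1 - β) • 1 + β • Kᵀ) := by
      rw [hA, hB, Mh_eq, Lh_eq]
      module
    rw [h1]
    refine ((AbsSumsLE.one.smul _).add (hK.transpose.smul _)).neg.mono ?_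
    rw [abs_of_nonneg (sub_nonneg.2 hβ1), abs_of_nonneg hβ0]
    linarith
  set X := T ⊗ₖ (A - B) with hXdef
  set Y := T ⊗ₖ (-A - B) with hYdef
  have hsplit : Ltilde = fromBlocks 1 0 0 (d • 1) + fromBlocks 0 0 (1 ⊗ₖ (c • A)) 0 +
      fromBlocks 1 0 0 (s • 1) *
        ((1 / 2 : ℝ) • fromBlocks (X + Y) (X - Y) (X - Y) (X + Y)) := by
    have hadd : X + Y = (2 : ℝ) • (T ⊗ₖ (-B)) := by
      rw [hXdef, hYdef, ← Matrix.kronecker_add, ← Matrix.kronecker_smul]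
      congr 1
      module
    have hsub : X - Y = (2 : ℝ) • (T ⊗ₖ A) := by
      rw [sub_eq_iff_eq_add, hXdef, hYdef, ← Matrix.kronecker_smul, ← Matrix.kronecker_add]
      congr 1
      module
    rw [hLt, hadd, hsub]
    simp only [blockBidiag_eq, ← hTdef, Matrix.fromBlocks_smul, Matrix.fromBlocks_multiply,
      Matrix.fromBlocks_add, ← smul_neg, Matrix.kronecker_smul, Matrix.one_kronecker_one,
      Matrix.kronecker_zero, smul_smul, Matrix.one_mul, Matrix.zero_mul, Matrix.smul_mul,
      zero_add, add_zero]
    norm_num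
  have hXY : ‖fromBlocks X 0 0 Y‖ ≤ 1 := by
    refine AbsSumsLE.l2_opNorm_le zero_le_one (AbsSumsLE.fromBlocks_diagonal ?_ ?_)
    · simpa using AbsSumsLE.kronecker zero_le_one hT hX
    · simpa using AbsSumsLE.kronecker zero_le_one hT hY
  have hdiag : ∀ a : ℝ, |a| ≤ 1 → ‖(fromBlocks 1 0 0 (a • 1) :
      Matrix ((Fin Nt × Fin (Nx - 1)) ⊕ (Fin Nt × Fin (Nx - 1)))
        ((Fin Nt × Fin (Nx - 1)) ⊕ (Fin Nt × Fin (Nx - 1))) ℝ)‖ ≤ 1 := fun a ha =>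
    AbsSumsLE.l2_opNorm_le zero_le_one
      (AbsSumsLE.fromBlocks_diagonal AbsSumsLE.one ((AbsSumsLE.one.smul a).mono (by simpa using ha)))
  have hlow : ‖(fromBlocks 0 0 (1 ⊗ₖ (c • A)) 0 :
      Matrix ((Fin Nt × Fin (Nx - 1)) ⊕ (Fin Nt × Fin (Nx - 1)))
        ((Fin Nt × Fin (Nx - 1)) ⊕ (Fin Nt × Fin (Nx - 1))) ℝ)‖ ≤ β := by
    refine AbsSumsLE.l2_opNorm_le hβ0 (AbsSumsLE.fromBlocks_lowerLeft hβ0 ?_)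
    refine (AbsSumsLE.kronecker zero_le_one AbsSumsLE.one (hA'.smul c)).mono ?_
    rw [one_mul]
    exact mul_le_of_le_one_left hβ0 hc
  have hhalf : ‖(1 / 2 : ℝ) • fromBlocks (X + Y) (X - Y) (X - Y) (X + Y)‖ ≤ 1 := by
    rw [norm_smul, Real.norm_of_nonneg (by norm_num)]
    linarith [l2_opNorm_fromBlocks_add_sub_le X Y]
  have hshift := (Matrix.l2_opNorm_mul (fromBlocks 1 0 0 (s • 1))
    ((1 / 2 : ℝ) • fromBlocks (X + Y) (X - Y) (X - Y) (X + Y))).trans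
    (mul_le_one₀ (hdiag s hs) (norm_nonneg _) hhalf)
  rw [hsplit]
  refine (norm_add_le _ _).trans ?_
  linarith [norm_add_le (fromBlocks 1 0 0 (d • 1) :
      Matrix ((Fin Nt × Fin (Nx - 1)) ⊕ (Fin Nt × Fin (Nx - 1)))
        ((Fin Nt × Fin (Nx - 1)) ⊕ (Fin Nt × Fin (Nx - 1))) ℝ)
      (fromBlocks 0 0 (1 ⊗ₖ (c • A)) 0), hdiag d hd]
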